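/- arXiv:2411.00507 — 17 statements merged into one kernel-verified Lean document; each statement's English description precedes it below -/
import Mathlib

section
/- Let R be a (possibly non-unital) associative ring and let a be an n×n matrix over R. Suppose that for each pair of indices (i, j) there are a natural number m_{ij} and an m_{ij}×m_{ij} matrix b_{ij} over R such that the 1×1 matrix (a_{ij}) satisfies a_{ij} ≾₁ b_{ij}. Then a ≾₁ b̃, where b̃ is the block-diagonal matrix whose diagonal blocks are the matrices b_{ij}, (i, j) ranging over all n² pairs. Moreover, if I is a two-sided ideal of R and every b_{ij} has all of its entries in I, then b̃ has all of its entries in I. -/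
open Matrix

/-- The relation `x ≾₁ y` between square matrices over a (possibly non-unital) ring:
`x = a * y * b` for some rectangular matrices `a`, `b` over `R`. -/
def Precsim1 {R : Type*} [NonUnitalRing R] {ι κ : Type*} [Fintype ι] [Fintype κ]
    (x : Matrix ι ι R) (y : Matrix κ κ R) : Prop :=
  ∃ (a : Matrix ι κ R) (b : Matrix κ ι R), x = a * y * b

/-- An element of `R` regarded as a `1 × 1` matrix. -/
def oneMat {R : Type*} (r : R) : Matrix (Fin 1) (Fin 1) R :=
  Matrix.of fun _ _ => r

theorem stmt1 {R : Type*} [NonUnitalRing R] {n : ℕ}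
    (a : Matrix (Fin n) (Fin n) R)
    (m : Fin n × Fin n → ℕ)
    (b : ∀ p : Fin n × Fin n, Matrix (Fin (m p)) (Fin (m p)) R)
    (h : ∀ i j, Precsim1 (oneMat (a i j)) (b (i, j))) :
    Precsim1 a (Matrix.blockDiagonal' b) ∧
      ∀ I : TwoSidedIdeal R, (∀ p i j, b p i j ∈ I) →
        ∀ i j, Matrix.blockDiagonal' b i j ∈ I := by
  constructor
  · have h' : ∀ p : Fin n × Fin n, Precsim1 (oneMat (a p.1 p.2)) (b p) := fun p => h p.1 p.2
    choose c d hcd using h'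
    let A : Matrix (Fin n) (Σ p, Fin (m p)) R :=
      Matrix.of fun i q => if q.1.1 = i then c q.1 0 q.2 else 0
    let B : Matrix (Σ p, Fin (m p)) (Fin n) R :=
      Matrix.of fun q j => if q.1.2 = j then d q.1 q.2 0 else 0
    have hA : ∀ i q, (A * Matrix.blockDiagonal' b) i q =
        if q.1.1 = i then (c q.1 * b q.1) 0 q.2 else 0 := by
      rintro i ⟨p, l⟩
      rw [Matrix.mul_apply, Fintype.sum_sigma, Finset.sum_eq_single p]
      · by_cases hp : p.1 = i <;>
          simp [A, hp, Matrix.mul_apply, Matrix.blockDiagonal'_apply_eq]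
      · intro q _ hq
        simp [Matrix.blockDiagonal'_apply_ne b _ _ hq]
      · simp
    refine ⟨A, B, ?_⟩
    ext i j
    rw [Matrix.mul_apply, Fintype.sum_sigma, Finset.sum_eq_single (i, j)]
    · simpa [hA, B, oneMat, Matrix.mul_apply] using congrFun (congrFun (hcd (i, j)) 0) 0
    · rintro ⟨i', j'⟩ - hq
      refine Finset.sum_eq_zero fun l _ => ?_
      by_cases hi : i' = i
      · have hj : j' ≠ j := fun hj => hq (by rw [hi, hj])
        simp [B, hj]
      · simp [hA, hi]
    · simp
  · rintro I hI ⟨p, k⟩ ⟨q, l⟩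
    by_cases hpq : p = q
    · subst hpq
      simpa only [Matrix.blockDiagonal'_apply_eq] using hI p k l
    · simpa only [Matrix.blockDiagonal'_apply_ne b k l hpq] using I.zero_mem
end

section
/- Let R be a (possibly non-unital) associative ring and let I and J be decomposable two-sided ideals of R. Then the two-sided ideal I + J is decomposable. -/
open Matrix

/-- A two-sided ideal `I` is decomposable if every square matrix with entries in `I`
is `≾₁`-below some square matrix with entries in `I`. -/
def IsDecomposable {R : Type*} [NonUnitalRing R] (I : TwoSidedIdeal R) : Prop :=
  ∀ (n : ℕ) (x : Matrix (Fin n) (Fin n) R), (∀ i j, x i j ∈ I) →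
    ∃ (m : ℕ) (y : Matrix (Fin m) (Fin m) R), (∀ i j, y i j ∈ I) ∧ Precsim1 x y


/-- A sum of two matrices lies `≾₁`-below the block-diagonal sum of matrices they lie below. -/
theorem Precsim1.add_fromBlocks {R : Type*} [NonUnitalRing R] {ι κ μ : Type*}
    [Fintype ι] [Fintype κ] [Fintype μ] {x x' : Matrix ι ι R} {y : Matrix κ κ R}
    {z : Matrix μ μ R} (h : Precsim1 x y) (h' : Precsim1 x' z) :
    Precsim1 (x + x') (fromBlocks y 0 0 z) := by
  obtain ⟨a, b, rfl⟩ := h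
  obtain ⟨c, d, rfl⟩ := h'
  refine ⟨fromCols a c, fromRows b d, ?_⟩
  ext i j
  simp [Matrix.mul_apply, Fintype.sum_sum_type]

theorem Precsim1.submatrix_equiv {R : Type*} [NonUnitalRing R] {ι κ μ : Type*}
    [Fintype ι] [Fintype κ] [Fintype μ] {x : Matrix ι ι R} {y : Matrix κ κ R}
    (h : Precsim1 x y) (e : μ ≃ κ) : Precsim1 x (y.submatrix e e) := by
  obtain ⟨a, b, rfl⟩ := h
  refine ⟨a.submatrix id e, b.submatrix e id, ?_⟩
  rw [submatrix_mul_equiv, submatrix_mul_equiv, submatrix_id_id]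

theorem stmt2 {R : Type*} [NonUnitalRing R] (I J : TwoSidedIdeal R)
    (hI : IsDecomposable I) (hJ : IsDecomposable J) :
    IsDecomposable (I ⊔ J) := by
  intro n x hx
  choose u hu v hv huv using fun i j => TwoSidedIdeal.mem_sup.1 (hx i j)
  obtain ⟨k, y, hy, hxy⟩ := hI n (Matrix.of u) hu
  obtain ⟨l, z, hz, hxz⟩ := hJ n (Matrix.of v) hv
  obtain rfl : Matrix.of u + Matrix.of v = x := by
    ext i j
    exact huv i j
  refine ⟨k + l, _, fun i j => ?_,
    (hxy.add_fromBlocks hxz).submatrix_equiv finSumFinEquiv.symm⟩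
  rw [submatrix_apply]
  rcases finSumFinEquiv.symm i with i | i <;> rcases finSumFinEquiv.symm j with j | j
  · exact TwoSidedIdeal.mem_sup_left (hy i j)
  · exact TwoSidedIdeal.zero_mem _
  · exact TwoSidedIdeal.zero_mem _
  · exact TwoSidedIdeal.mem_sup_right (hz i j)
end

section
/- Let R be a (possibly non-unital) associative ring and let I and J be decomposable two-sided ideals of R. Define I ∧ J = { x ∈ R : there exist m and an m×m matrix y over R all of whose entries lie in I ∩ J such that the 1×1 matrix (x) satisfies x ≾₁ y }. Then: (a) I ∧ J is a two-sided ideal of R; (b) I·J ⊆ I ∧ J ⊆ I ∩ J, where I·J denotes the additive subgroup generated by all products a*b with a ∈ I and b ∈ J; and (c) every decomposable two-sided ideal of R contained in I ∩ J is contained in I ∧ J. -/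
open Matrix

/-- The set `I ∧ J` of elements `x ∈ R` such that the `1 × 1` matrix `(x)` is
`≾₁`-below some square matrix with entries in `I ∩ J`. -/
def meetSet {R : Type*} [NonUnitalRing R] (I J : TwoSidedIdeal R) : Set R :=
  {x | ∃ (m : ℕ) (y : Matrix (Fin m) (Fin m) R),
    (∀ i j, y i j ∈ I ∧ y i j ∈ J) ∧ Precsim1 (oneMat x) y}

/-- The additive subgroup generated by the products `a * y * b` with `y ∈ I`. -/
def sandwich {R : Type*} [NonUnitalRing R] (I : TwoSidedIdeal R) : AddSubgroup R :=
  AddSubgroup.closure {z : R | ∃ a, ∃ y ∈ I, ∃ b, z = a * y * b}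

section Sandwich

variable {R : Type*} [NonUnitalRing R] {I J : TwoSidedIdeal R}

lemma mul_mul_mem_sandwich (a : R) {y : R} (hy : y ∈ I) (b : R) : a * y * b ∈ sandwich I :=
  AddSubgroup.subset_closure ⟨a, y, hy, b, rfl⟩

lemma mem_sandwich_of_precsim1 {m : ℕ} {x : R} {y : Matrix (Fin m) (Fin m) R}
    (hy : ∀ i j, y i j ∈ I) (h : Precsim1 (oneMat x) y) : x ∈ sandwich I := by
  obtain ⟨a, b, h⟩ := h
  have hx : x = (a * y * b) 0 0 := by rw [← h]; rfl
  rw [hx, Matrix.mul_apply]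
  refine sum_mem fun j _ => ?_
  rw [Matrix.mul_apply, Finset.sum_mul]
  exact sum_mem fun i _ => mul_mul_mem_sandwich _ (hy i j) _

lemma IsDecomposable.mem_sandwich (hI : IsDecomposable I) {x : R} (hx : x ∈ I) :
    x ∈ sandwich I := by
  obtain ⟨m, y, hy, h⟩ := hI 1 (oneMat x) fun _ _ => hx
  exact mem_sandwich_of_precsim1 hy h

lemma exists_sum_of_mem_sandwich {x : R} (hx : x ∈ sandwich I) :
    ∃ (n : ℕ) (a y b : Fin n → R), (∀ i, y i ∈ I) ∧ x = ∑ i, a i * y i * b i := by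
  induction hx using AddSubgroup.closure_induction with
  | mem x hx =>
    obtain ⟨a, y, hy, b, rfl⟩ := hx
    exact ⟨1, fun _ => a, fun _ => y, fun _ => b, fun _ => hy, by simp⟩
  | zero => exact ⟨0, 0, 0, 0, fun i => i.elim0, by simp⟩
  | add x x' _ _ hx hx' =>
    obtain ⟨n, a, y, b, hy, rfl⟩ := hx
    obtain ⟨n', a', y', b', hy', rfl⟩ := hx'
    refine ⟨n + n', Fin.append a a', Fin.append y y', Fin.append b b', fun i => ?_, ?_⟩
    · induction i using Fin.addCases <;> simp [hy, hy']
    · simp [Fin.sum_univ_add]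
  | neg x _ hx =>
    obtain ⟨n, a, y, b, hy, rfl⟩ := hx
    exact ⟨n, -a, y, b, hy, by simp⟩

lemma coe_sandwich_inf : (sandwich (I ⊓ J) : Set R) = meetSet I J := by
  ext x
  constructor
  · intro hx
    obtain ⟨n, a, y, b, hy, rfl⟩ := exists_sum_of_mem_sandwich hx
    refine ⟨n, Matrix.diagonal y, fun i j => ?_, Matrix.of fun _ i => a i,
      Matrix.of fun i _ => b i, ?_⟩
    · rw [← TwoSidedIdeal.mem_inf R]
      by_cases hij : i = j
      · subst hij
        simpa using hy i
      · rw [Matrix.diagonal_apply_ne _ hij]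
        exact zero_mem _
    · ext i j
      simp [oneMat, Matrix.mul_apply (M := _ * _), Matrix.mul_diagonal]
  · rintro ⟨m, y, hy, h⟩
    exact mem_sandwich_of_precsim1 (fun i j => (TwoSidedIdeal.mem_inf R).2 (hy i j)) h

lemma sandwich_mono (h : I ≤ J) : sandwich I ≤ sandwich J :=
  AddSubgroup.closure_mono fun _ ⟨a, y, hy, b, hz⟩ => ⟨a, y, h hy, b, hz⟩

lemma mem_of_mem_sandwich {x : R} (hx : x ∈ sandwich I) : x ∈ I := by
  obtain ⟨n, a, y, b, hy, rfl⟩ := exists_sum_of_mem_sandwich hx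
  exact sum_mem fun i _ => I.mul_mem_right _ _ (I.mul_mem_left _ _ (hy i))

lemma mul_mem_sandwich_left (r : R) {x : R} (hx : x ∈ sandwich I) : r * x ∈ sandwich I := by
  obtain ⟨n, a, y, b, hy, rfl⟩ := exists_sum_of_mem_sandwich hx
  rw [Finset.mul_sum]
  refine sum_mem fun i _ => ?_
  simpa only [mul_assoc] using mul_mul_mem_sandwich (r * a i) (hy i) (b i)

lemma mul_mem_sandwich_right {x : R} (hx : x ∈ sandwich I) (r : R) : x * r ∈ sandwich I := by
  obtain ⟨n, a, y, b, hy, rfl⟩ := exists_sum_of_mem_sandwich hx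
  rw [Finset.sum_mul]
  refine sum_mem fun i _ => ?_
  simpa only [mul_assoc] using mul_mul_mem_sandwich (a i) (hy i) (b i * r)

lemma mul_mem_sandwich_inf {x x' : R} (hx : x ∈ sandwich I) (hx' : x' ∈ sandwich J) :
    x * x' ∈ sandwich (I ⊓ J) := by
  obtain ⟨n, a, y, b, hy, rfl⟩ := exists_sum_of_mem_sandwich hx
  obtain ⟨n', a', y', b', hy', rfl⟩ := exists_sum_of_mem_sandwich hx'
  rw [Finset.sum_mul_sum]
  refine sum_mem fun i _ => sum_mem fun j _ => ?_
  have h : y i * (b i * a' j) * y' j ∈ I ⊓ J := (TwoSidedIdeal.mem_inf R).2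
    ⟨I.mul_mem_right _ _ (I.mul_mem_right _ _ (hy i)), J.mul_mem_left _ _ (hy' j)⟩
  simpa only [mul_assoc] using mul_mul_mem_sandwich (a i) h (b' j)

end Sandwich

theorem stmt3 {R : Type*} [NonUnitalRing R] (I J : TwoSidedIdeal R)
    (hI : IsDecomposable I) (hJ : IsDecomposable J) :
    (∃ K : TwoSidedIdeal R, (K : Set R) = meetSet I J) ∧
    (∀ x ∈ AddSubgroup.closure {z : R | ∃ a ∈ I, ∃ b ∈ J, z = a * b},
      x ∈ meetSet I J) ∧
    (∀ x ∈ meetSet I J, x ∈ I ∧ x ∈ J) ∧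
    (∀ K : TwoSidedIdeal R, IsDecomposable K → (∀ x ∈ K, x ∈ I ∧ x ∈ J) →
      ∀ x ∈ K, x ∈ meetSet I J) := by
  rw [← coe_sandwich_inf]
  refine ⟨⟨.mk' (sandwich (I ⊓ J)) (zero_mem _) add_mem neg_mem
    (fun h => mul_mem_sandwich_left _ h) (fun h => mul_mem_sandwich_right h _), ?_⟩,
    fun x hx => ?_, fun x hx => (TwoSidedIdeal.mem_inf R).1 (mem_of_mem_sandwich hx),
    fun K hK hle x hx => ?_⟩
  · exact TwoSidedIdeal.coe_mk' ..
  · refine (AddSubgroup.closure_le _).2 ?_ hx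
    rintro _ ⟨a, ha, b, hb, rfl⟩
    exact mul_mem_sandwich_inf (hI.mem_sandwich ha) (hJ.mem_sandwich hb)
  · exact sandwich_mono (fun y hy => (TwoSidedIdeal.mem_inf R).2 (hle y hy)) (hK.mem_sandwich hx)
end

section
/- Let R be a (possibly non-unital) associative ring and let I be a two-sided ideal of R that is idempotent, i.e., every element of I is a finite sum of products y*z with y, z ∈ I. Then I is decomposable. -/
open Matrix

/-- `Factors I x` says that `x = a * y * b` for some square matrix `y`, of arbitrary finite size,
all of whose entries lie in `I`. -/
def Factors {R : Type*} [NonUnitalRing R] (I : TwoSidedIdeal R) {ι : Type*} [Fintype ι]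
    (x : Matrix ι ι R) : Prop :=
  ∃ (κ : Type) (_ : Fintype κ) (y : Matrix κ κ R), (∀ i j, y i j ∈ I) ∧ Precsim1 x y

namespace Factors

variable {R : Type*} [NonUnitalRing R] {I : TwoSidedIdeal R} {ι : Type*} [Fintype ι]

theorem zero : Factors I (0 : Matrix ι ι R) :=
  ⟨Empty, inferInstance, 0, fun i => i.elim, 0, 0, by simp⟩

theorem neg {x : Matrix ι ι R} (hx : Factors I x) : Factors I (-x) := by
  obtain ⟨κ, _, y, hy, a, b, rfl⟩ := hx
  exact ⟨κ, inferInstance, y, hy, -a, b, by simp only [Matrix.neg_mul]⟩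

theorem add {x x' : Matrix ι ι R} (hx : Factors I x) (hx' : Factors I x') :
    Factors I (x + x') := by
  obtain ⟨κ, _, y, hy, a, b, rfl⟩ := hx
  obtain ⟨κ', _, y', hy', a', b', rfl⟩ := hx'
  refine ⟨κ ⊕ κ', inferInstance, fromBlocks y 0 0 y', ?_, fromCols a a', fromRows b b', ?_⟩
  · rintro (i | i) (j | j) <;> simp [hy, hy', I.zero_mem]
  · ext i j
    simp [Matrix.mul_apply, Fintype.sum_sum_type]

theorem sum {α : Type*} (s : Finset α) {f : α → Matrix ι ι R} (hf : ∀ k ∈ s, Factors I (f k)) :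
    Factors I (∑ k ∈ s, f k) :=
  Finset.sum_induction f (Factors I) (fun _ _ => add) zero hf

theorem single_mul_mul [DecidableEq ι] (i j : ι) (p r : R) {q : R} (hq : q ∈ I) :
    Factors I (single i j (p * q * r)) := by
  refine ⟨Unit, inferInstance, of fun _ _ => q, fun _ _ => hq, single i () p, single () j r, ?_⟩
  have : (of fun _ _ => q : Matrix Unit Unit R) = single () () q := by
    ext; simp
  rw [this, single_mul_single_same, single_mul_single_same]

theorem single_of_mem [DecidableEq ι]
    (hidem : ∀ x ∈ I, x ∈ AddSubgroup.closure {z : R | ∃ y ∈ I, ∃ w ∈ I, z = y * w})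
    (i j : ι) {x : R} (hx : x ∈ I) : Factors I (single i j x) := by
  have key : ∀ y ∈ I, ∀ w, Factors I (single i j (y * w)) := by
    intro y hy w
    have hy' := hidem y hy
    clear hy
    induction hy' using AddSubgroup.closure_induction with
    | mem z hz =>
      obtain ⟨u, _, v, hv, rfl⟩ := hz
      exact single_mul_mul i j u w hv
    | zero => simpa using zero
    | add a b _ _ ha hb => simpa only [add_mul, single_add] using ha.add hb
    | neg a _ ha => simpa only [neg_mul, single_neg] using ha.neg
  have hx' := hidem x hx
  clear hx
  induction hx' using AddSubgroup.closure_induction with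
  | mem z hz =>
    obtain ⟨y, hy, w, _, rfl⟩ := hz
    exact key y hy w
  | zero => simpa using zero
  | add a b _ _ ha hb => simpa only [single_add] using ha.add hb
  | neg a _ ha => simpa only [single_neg] using ha.neg

theorem exists_fin {x : Matrix ι ι R} (hx : Factors I x) :
    ∃ (m : ℕ) (y : Matrix (Fin m) (Fin m) R), (∀ i j, y i j ∈ I) ∧ Precsim1 x y := by
  obtain ⟨κ, _, y, hy, a, b, rfl⟩ := hx
  let e := (Fintype.equivFin κ).symm
  refine ⟨_, y.submatrix e e, fun _ _ => hy _ _, a.submatrix id e, b.submatrix e id, ?_⟩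
  rw [submatrix_mul_equiv, submatrix_mul_equiv, submatrix_id_id]

end Factors

theorem stmt4 {R : Type*} [NonUnitalRing R] (I : TwoSidedIdeal R)
    (hidem : ∀ x ∈ I, x ∈ AddSubgroup.closure {z : R | ∃ y ∈ I, ∃ w ∈ I, z = y * w}) :
    IsDecomposable I := by
  intro n x hx
  rw [matrix_eq_sum_single x]
  exact (Factors.sum _ fun i _ => Factors.sum _ fun j _ =>
    Factors.single_of_mem hidem i j (hx i j)).exists_fin
end

section
/- Let A be a (not necessarily unital) C*-algebra and let I be a closed two-sided ideal of A. Then I is decomposable: for every n and every n×n matrix x over A all of whose entries lie in I, there exist m and an m×m matrix y over A all of whose entries lie in I such that x ≾₁ y. -/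
open Matrix

/-- A self-adjoint element `k` has approximate inverses `r` in the sense that `k * k * r` is
close to `k`. -/
lemma IsSelfAdjoint.exists_norm_mul_mul_sub_le {A : Type*} [NonUnitalCStarAlgebra A] {k : A}
    (hk : IsSelfAdjoint k) {ε : ℝ} (hε : 0 < ε) :
    ∃ r : A, ‖k * k * r - k‖ ≤ ε := by
  have hcont : Continuous fun t : ℝ => t / (t ^ 2 + ε ^ 2) :=
    continuous_id.div (by fun_prop) fun t => by positivity
  have hcont' : Continuous fun t : ℝ => t * t * (t / (t ^ 2 + ε ^ 2)) :=
    (continuous_id.mul continuous_id).mul hcont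
  refine ⟨cfcₙ (fun t : ℝ => t / (t ^ 2 + ε ^ 2)) k, ?_⟩
  have h : k * k * cfcₙ (fun t : ℝ => t / (t ^ 2 + ε ^ 2)) k - k =
      cfcₙ (fun t : ℝ => t * t * (t / (t ^ 2 + ε ^ 2)) - t) k := by
    rw [cfcₙ_sub _ _ k hcont'.continuousOn (by simp) (by fun_prop) (by simp),
      cfcₙ_mul _ _ k (by fun_prop) (by simp) hcont.continuousOn (by simp),
      cfcₙ_mul _ _ k (by fun_prop) (by simp) (by fun_prop) (by simp), cfcₙ_id' ℝ k hk]
  rw [h]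
  refine norm_cfcₙ_le fun t _ => ?_
  have hd : 0 < t ^ 2 + ε ^ 2 := by positivity
  have e : t * t * (t / (t ^ 2 + ε ^ 2)) - t = -(t * ε) * ε / (t ^ 2 + ε ^ 2) := by
    field_simp
    ring
  rw [e, Real.norm_eq_abs, abs_le, le_div_iff₀ hd, div_le_iff₀ hd]
  constructor <;> nlinarith [sq_nonneg (t - ε), sq_nonneg (t + ε), sq_nonneg t, sq_nonneg ε,
    mul_nonneg hε.le (sq_nonneg (t - ε)), mul_nonneg hε.le (sq_nonneg (t + ε)),
    mul_nonneg hε.le (sq_nonneg t), mul_nonneg hε.le (sq_nonneg ε)]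

/-- A closed ideal contains every self-adjoint element whose square it contains. -/
lemma TwoSidedIdeal.mem_of_mul_self_mem {A : Type*} [NonUnitalCStarAlgebra A]
    {I : TwoSidedIdeal A} (hI : IsClosed (I : Set A)) {k : A} (hk : IsSelfAdjoint k)
    (h : k * k ∈ I) : k ∈ I := by
  have hmem : k ∈ closure (I : Set A) := by
    refine Metric.mem_closure_iff.2 fun ε hε => ?_
    obtain ⟨r, hr⟩ := hk.exists_norm_mul_mul_sub_le (half_pos hε)
    refine ⟨k * k * r, I.mul_mem_right _ _ h, ?_⟩
    rw [dist_comm, dist_eq_norm]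
    linarith
  rwa [hI.closure_eq] at hmem

/-- The norm of `a` depends only on `star a * a`. -/
lemma CStarRing.norm_eq_norm_of_star_mul_self_eq {A : Type*} [NonUnitalCStarAlgebra A] {a b : A}
    (h : star a * a = star b * b) : ‖a‖ = ‖b‖ := by
  have := congrArg norm h
  rwa [CStarRing.norm_star_mul_self, CStarRing.norm_star_mul_self,
    mul_self_inj (norm_nonneg _) (norm_nonneg _)] at this

/-- If `|x| = k * k` with `k` self-adjoint, then `x` is left divisible by `k`. -/
lemma exists_eq_mul_of_star_mul_self_eq {A : Type*} [NonUnitalCStarAlgebra A] {x k : A}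
    (hk : IsSelfAdjoint k) (h : star x * x = k * k * (k * k)) : ∃ u, x = u * k := by
  have hx : star x * x = star (k * k) * (k * k) := by
    rw [star_mul, hk.star_eq, h]
  have hmul (c : A) : ‖x * c‖ = ‖k * k * c‖ := by
    apply CStarRing.norm_eq_norm_of_star_mul_self_eq
    rw [star_mul, star_mul (k * k), mul_assoc, ← mul_assoc (star x), hx]
    simp only [mul_assoc]
  have hmul_sub (c : A) : ‖x * c - x‖ = ‖k * k * c - k * k‖ := by
    apply CStarRing.norm_eq_norm_of_star_mul_self_eq
    have expand (y : A) : star (y * c - y) * (y * c - y) =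
        star c * (star y * y) * c - star c * (star y * y) - (star y * y) * c + star y * y := by
      simp only [star_sub, star_mul, sub_mul, mul_sub, mul_assoc]
      abel
    rw [expand, expand, hx]
  choose r hr using fun n : ℕ =>
    hk.exists_norm_mul_mul_sub_le (Nat.one_div_pos_of_nat (α := ℝ) (n := n))
  have hlim : Filter.Tendsto (fun n => k * k * r n) Filter.atTop (nhds k) := by
    rw [tendsto_iff_norm_sub_tendsto_zero]
    exact squeeze_zero (fun _ => norm_nonneg _) hr tendsto_one_div_add_atTop_nhds_zero_nat
  have hcauchy : CauchySeq fun n => x * r n := by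
    have := hlim.cauchySeq
    rw [Metric.cauchySeq_iff] at this ⊢
    simpa only [dist_eq_norm, ← mul_sub, hmul] using this
  obtain ⟨u, hu⟩ := cauchySeq_tendsto_of_complete hcauchy
  refine ⟨u, tendsto_nhds_unique ?_ (hu.mul_const k)⟩
  rw [tendsto_iff_norm_sub_tendsto_zero]
  have := tendsto_iff_norm_sub_tendsto_zero.1 (hlim.mul_const k)
  refine this.congr fun n => ?_
  rw [mul_assoc x, hmul_sub, mul_assoc (k * k)]

/-- Every element of a closed ideal of a C⋆-algebra factors as a product whose middle factor lies
in the ideal. -/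
lemma TwoSidedIdeal.exists_eq_mul_mul {A : Type*} [NonUnitalCStarAlgebra A]
    {I : TwoSidedIdeal A} (hI : IsClosed (I : Set A)) {x : A} (hx : x ∈ I) :
    ∃ u, ∃ y ∈ I, ∃ v, x = u * y * v := by
  let _ := CStarAlgebra.spectralOrder A
  have := CStarAlgebra.spectralOrderedRing A
  have hsqrt (a : A) : IsSelfAdjoint (CFC.sqrt a) := (CFC.sqrt_nonneg a).isSelfAdjoint
  have hl := CFC.sqrt_mul_sqrt_self (star x * x) (star_mul_self_nonneg x)
  set p := CFC.sqrt (star x * x)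
  have hk := CFC.sqrt_mul_sqrt_self p (CFC.sqrt_nonneg _)
  set k := CFC.sqrt p
  have hl' := CFC.sqrt_mul_sqrt_self k (CFC.sqrt_nonneg _)
  set l := CFC.sqrt k
  have hpI : p ∈ I := mem_of_mul_self_mem hI (hsqrt _) (hl ▸ I.mul_mem_left _ _ hx)
  have hkI : k ∈ I := mem_of_mul_self_mem hI (hsqrt _) (hk ▸ hpI)
  have hlI : l ∈ I := mem_of_mul_self_mem hI (hsqrt _) (hl' ▸ hkI)
  obtain ⟨u, hu⟩ := exists_eq_mul_of_star_mul_self_eq (x := x) (k := k) (hsqrt _)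
    (by rw [hk, hl])
  exact ⟨u, l, hlI, l, by rw [mul_assoc, hl', hu]⟩

theorem stmt5 {A : Type*} [NonUnitalCStarAlgebra A] (I : TwoSidedIdeal A)
    (hI : IsClosed (I : Set A)) :
    IsDecomposable I := by
  intro n x hx
  choose u y hy v h using fun i j => I.exists_eq_mul_mul hI (hx i j)
  let e := (finProdFinEquiv (m := n) (n := n)).symm
  refine ⟨n * n, diagonal fun p => y (e p).1 (e p).2, fun i j => ?_,
    of fun i p => if (e p).1 = i then u (e p).1 (e p).2 else 0,
    of fun p j => if (e p).2 = j then v (e p).1 (e p).2 else 0, ?_⟩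
  · rw [diagonal_apply]
    split_ifs
    exacts [hy _ _, I.zero_mem]
  · ext i j
    rw [mul_apply]
    simp only [mul_diagonal, of_apply]
    rw [e.sum_comp fun q : Fin n × Fin n =>
      (if q.1 = i then u q.1 q.2 else 0) * y q.1 q.2 * (if q.2 = j then v q.1 q.2 else 0),
      Fintype.sum_prod_type]
    simp [h i j]
end

section
/- Let R be a (possibly non-unital) associative ring that is idempotent, i.e., every element of R is a finite sum of products y*z with y, z ∈ R. Then the relation ≾₁ is dense: if x is an n×n matrix and y an m×m matrix over R with x ≾₁ y, then there exist k and a k×k matrix z over R such that x ≾₁ z and z ≾₁ y. -/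
open Matrix

theorem Matrix.fromCols_mul_fromRows_of_nonUnital {R : Type*} [NonUnitalNonAssocSemiring R]
    {ι κ σ τ : Type*} [Fintype σ] [Fintype τ] (B : Matrix ι σ R) (B' : Matrix ι τ R)
    (C : Matrix σ κ R) (C' : Matrix τ κ R) :
    fromCols B B' * fromRows C C' = B * C + B' * C' := by
  ext
  simp [mul_apply]

/-- The matrices that factor as a product of two matrices over `R`. -/
def Matrix.factorable (R : Type*) [NonUnitalRing R] (ι κ : Type*) :
    AddSubgroup (Matrix ι κ R) where
  carrier := {A | ∃ (τ : Type) (_ : Fintype τ) (B : Matrix ι τ R) (C : Matrix τ κ R), A = B * C}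
  zero_mem' := ⟨Empty, inferInstance, 0, 0, by simp⟩
  add_mem' := by
    rintro _ _ ⟨σ, _, B, C, rfl⟩ ⟨τ, _, B', C', rfl⟩
    exact ⟨σ ⊕ τ, inferInstance, fromCols B B', fromRows C C',
      (fromCols_mul_fromRows_of_nonUnital B B' C C').symm⟩
  neg_mem' := by
    rintro _ ⟨τ, _, B, C, rfl⟩
    exact ⟨τ, inferInstance, -B, C, (Matrix.neg_mul B C).symm⟩

theorem Matrix.mem_factorable_of_idempotent {R : Type*} [NonUnitalRing R]
    (hidem : ∀ x : R, x ∈ AddSubgroup.closure {z : R | ∃ y w : R, z = y * w})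
    {ι κ : Type*} [Fintype ι] [Fintype κ] (A : Matrix ι κ R) : A ∈ factorable R ι κ := by
  classical
  rw [matrix_eq_sum_single A]
  refine sum_mem fun i _ => sum_mem fun j _ => ?_
  have hle : AddSubgroup.closure {z : R | ∃ y w : R, z = y * w} ≤
      (factorable R ι κ).comap (singleAddMonoidHom i j) := by
    rw [AddSubgroup.closure_le]
    rintro _ ⟨y, w, rfl⟩
    exact ⟨Unit, inferInstance, single i () y, single () j w, by simp⟩
  exact hle (hidem (A i j))

/-- Interpolation through a square matrix indexed by an arbitrary finite type `τ` can be
transported to `Fin k`. -/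
theorem exists_fin_interpolant {R : Type*} [NonUnitalRing R] {ι κ τ : Type*}
    [Fintype ι] [Fintype κ] [Fintype τ] {x : Matrix ι ι R} {y : Matrix κ κ R}
    {z : Matrix τ τ R} (hxz : Precsim1 x z) (hzy : Precsim1 z y) :
    ∃ (k : ℕ) (z : Matrix (Fin k) (Fin k) R), Precsim1 x z ∧ Precsim1 z y := by
  obtain ⟨a, b, hx⟩ := hxz
  obtain ⟨c, d, hz⟩ := hzy
  let e := (Fintype.equivFin τ).symm
  refine ⟨Fintype.card τ, z.submatrix e e, ⟨a.submatrix id e, b.submatrix e id, ?_⟩,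
    ⟨c.submatrix e id, d.submatrix id e, ?_⟩⟩
  · rw [submatrix_mul_equiv, submatrix_mul_equiv, submatrix_id_id, hx]
  · rw [hz]
    rfl

theorem stmt7 {R : Type*} [NonUnitalRing R]
    (hidem : ∀ x : R, x ∈ AddSubgroup.closure {z : R | ∃ y w : R, z = y * w})
    {n m : ℕ} (x : Matrix (Fin n) (Fin n) R) (y : Matrix (Fin m) (Fin m) R)
    (h : Precsim1 x y) :
    ∃ (k : ℕ) (z : Matrix (Fin k) (Fin k) R), Precsim1 x z ∧ Precsim1 z y := by
  obtain ⟨a, b, rfl⟩ := h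
  obtain ⟨σ, _, a₁, a₂, rfl⟩ := mem_factorable_of_idempotent hidem a
  obtain ⟨τ, _, b₁, b₂, rfl⟩ := mem_factorable_of_idempotent hidem b
  refine exists_fin_interpolant (τ := σ ⊕ τ)
    (z := fromRows a₂ 0 * y * fromCols 0 b₁)
    ⟨fromCols a₁ 0, fromRows 0 b₂, ?_⟩ ⟨_, _, rfl⟩
  calc a₁ * a₂ * y * (b₁ * b₂)
      = (fromCols a₁ (0 : Matrix (Fin n) τ R) * fromRows a₂ (0 : Matrix τ (Fin m) R)) * y *
          (fromCols (0 : Matrix (Fin m) σ R) b₁ * fromRows (0 : Matrix σ (Fin n) R) b₂) := by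
        rw [fromCols_mul_fromRows_of_nonUnital, fromCols_mul_fromRows_of_nonUnital]
        simp
    _ = _ := by simp only [Matrix.mul_assoc]
end

section
/- Let R be a (possibly non-unital) associative ring and let I be a two-sided ideal of R that is pure as a right ideal, i.e., for every y ∈ I there exists s ∈ I with s * y = y. Then I is quasipure. -/
open Matrix

/-- A two-sided ideal `I` is quasipure if for every square matrix `x` with entries in `I`
there are square matrices `s`, `y` with entries in `I` such that `s * y = y` and `x ≾₁ y`. -/
def IsQuasipure {R : Type*} [NonUnitalRing R] (I : TwoSidedIdeal R) : Prop :=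
  ∀ (n : ℕ) (x : Matrix (Fin n) (Fin n) R), (∀ i j, x i j ∈ I) →
    ∃ (m : ℕ) (s y : Matrix (Fin m) (Fin m) R),
      (∀ i j, s i j ∈ I) ∧ (∀ i j, y i j ∈ I) ∧ s * y = y ∧ Precsim1 x y


/-- Tominaga's trick: if every element of a two-sided ideal has a left unit in the ideal, then
so does every finite subset of the ideal. -/
theorem TwoSidedIdeal.exists_common_left_unit {R : Type*} [NonUnitalRing R] (I : TwoSidedIdeal R)
    (hpure : ∀ y ∈ I, ∃ s ∈ I, s * y = y) {ι : Type*} (F : Finset ι) (f : ι → R)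
    (hf : ∀ i ∈ F, f i ∈ I) : ∃ s ∈ I, ∀ i ∈ F, s * f i = f i := by
  classical
  induction F using Finset.induction_on with
  | empty => exact ⟨0, I.zero_mem, by simp⟩
  | insert j F _ ih =>
    obtain ⟨e, he, hef⟩ := ih fun i hi => hf i (Finset.mem_insert_of_mem hi)
    have hj : f j ∈ I := hf j (Finset.mem_insert_self j F)
    obtain ⟨s, hs, hsj⟩ := hpure (f j - e * f j) (I.sub_mem hj (I.mul_mem_left _ _ hj))
    refine ⟨s + e - s * e, I.sub_mem (I.add_mem hs he) (I.mul_mem_left _ _ he), fun i hi => ?_⟩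
    rcases Finset.mem_insert.mp hi with rfl | hi
    · calc (s + e - s * e) * f i = s * (f i - e * f i) + e * f i := by noncomm_ring
        _ = f i := by rw [hsj, sub_add_cancel]
    · rw [sub_mul, add_mul, mul_assoc, hef i hi, add_sub_cancel_left]

theorem stmt9 {R : Type*} [NonUnitalRing R] (I : TwoSidedIdeal R)
    (hpure : ∀ y ∈ I, ∃ s ∈ I, s * y = y) :
    IsQuasipure I := by
  intro n x hx
  obtain ⟨s, hs, hsx⟩ := I.exists_common_left_unit hpure Finset.univ
    (fun p : Fin n × Fin n => x p.1 p.2) fun p _ => hx p.1 p.2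
  obtain ⟨t, ht, hts⟩ := hpure s hs
  have diagonal_mem : ∀ r ∈ I, ∀ i j : Fin n, Matrix.diagonal (fun _ => r) i j ∈ I := by
    intro r hr i j
    rw [Matrix.diagonal_apply]
    split_ifs
    exacts [hr, I.zero_mem]
  have hmul : Matrix.diagonal (fun _ : Fin n => t) * Matrix.diagonal (fun _ => s) =
      Matrix.diagonal fun _ => s := by
    rw [Matrix.diagonal_mul_diagonal, hts]
  refine ⟨n, Matrix.diagonal fun _ => t, Matrix.diagonal fun _ => s, diagonal_mem t ht,
    diagonal_mem s hs, hmul, Matrix.diagonal fun _ => t, x, ?_⟩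
  rw [hmul]
  ext i j
  rw [Matrix.diagonal_mul]
  exact (hsx (i, j) (Finset.mem_univ _)).symm
end

section
/- Let R be a (possibly non-unital) associative ring and let I be a two-sided ideal of R. The following are equivalent: (i) I is quasipure; (ii) for every n and every n×n matrix x over R with all entries in I, there exist m, an n×m matrix r over the unitization R⁺ = ℤ ⊕ R, an m×n matrix y over R with all entries in I, and an m×m matrix s over R with all entries in I, such that x = r * y (the product computed over R⁺ after embedding y) and s * y = y; (iii) for every n and every n×n matrix x over R with all entries in I, there exist m, an n×m matrix r with all entries in I, an m×n matrix y with all entries in I, and an m×m matrix s with all entries in I, such that x = r * y and s * y = y. -/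
open Matrix

/-- Condition (ii): every square matrix `x` with entries in `I` factors as `x = r * y`
with `r` a rectangular matrix over the unitization `R⁺ = ℤ ⊕ R`, `y` a rectangular matrix
with entries in `I`, and `s * y = y` for some square matrix `s` with entries in `I`. -/
def CondII {R : Type*} [NonUnitalRing R] (I : TwoSidedIdeal R) : Prop :=
  ∀ (n : ℕ) (x : Matrix (Fin n) (Fin n) R), (∀ i j, x i j ∈ I) →
    ∃ (m : ℕ) (r : Matrix (Fin n) (Fin m) (Unitization ℤ R))
      (y : Matrix (Fin m) (Fin n) R) (s : Matrix (Fin m) (Fin m) R),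
      (∀ i j, y i j ∈ I) ∧ (∀ i j, s i j ∈ I) ∧
      x.map (Unitization.inr : R → Unitization ℤ R) =
        r * y.map (Unitization.inr : R → Unitization ℤ R) ∧
      s * y = y

/-- Condition (iii): the same as condition (ii), but with `r` a matrix with entries in `I`
and the product `x = r * y` computed over `R`. -/
def CondIII {R : Type*} [NonUnitalRing R] (I : TwoSidedIdeal R) : Prop :=
  ∀ (n : ℕ) (x : Matrix (Fin n) (Fin n) R), (∀ i j, x i j ∈ I) →
    ∃ (m : ℕ) (r : Matrix (Fin n) (Fin m) R)
      (y : Matrix (Fin m) (Fin n) R) (s : Matrix (Fin m) (Fin m) R),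
      (∀ i j, r i j ∈ I) ∧ (∀ i j, y i j ∈ I) ∧ (∀ i j, s i j ∈ I) ∧
      x = r * y ∧ s * y = y

theorem TwoSidedIdeal.matrix_mul_mem_right {R ι κ μ : Type*} [NonUnitalRing R] [Fintype κ]
    (I : TwoSidedIdeal R) {a : Matrix ι κ R} (b : Matrix κ μ R) (ha : ∀ i j, a i j ∈ I)
    (i : ι) (j : μ) : (a * b) i j ∈ I := by
  rw [Matrix.mul_apply]
  exact sum_mem fun k _ => I.mul_mem_right _ _ (ha i k)

/-- If the image of `I` in a larger ring `S` absorbs left multiplication by `S`, then a left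
factor over `S` of a matrix fixed by a matrix over `I` may be replaced by one over `I`. -/
theorem TwoSidedIdeal.exists_eq_mul_of_map_eq_mul {R S ι κ μ : Type*} [NonUnitalRing R]
    [NonUnitalRing S] [Fintype κ] (I : TwoSidedIdeal R) {φ : R →ₙ+* S}
    (hφ : Function.Injective φ) (hI : ∀ (c : S), ∀ a ∈ I, ∃ b ∈ I, φ b = c * φ a)
    {x : Matrix ι μ R} {r : Matrix ι κ S} {y : Matrix κ μ R} {s : Matrix κ κ R}
    (hs : ∀ i j, s i j ∈ I) (hx : x.map φ = r * y.map φ) (hsy : s * y = y) :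
    ∃ t : Matrix ι κ R, (∀ i j, t i j ∈ I) ∧ x = t * y := by
  choose f hfI hf using hI
  let t : Matrix ι κ R := of fun i j => ∑ k, f (r i k) (s k j) (hs k j)
  have ht : t.map φ = r * s.map φ := by
    ext i j
    simp [t, hf, Matrix.mul_apply]
  refine ⟨t, fun i j => sum_mem fun k _ => hfI _ _ (hs k j), Matrix.map_injective hφ ?_⟩
  change x.map φ = (t * y).map φ
  rw [Matrix.map_mul, ht, Matrix.mul_assoc, ← Matrix.map_mul, hsy, hx]

theorem TwoSidedIdeal.exists_inr_eq_mul {R : Type*} [NonUnitalRing R] (I : TwoSidedIdeal R)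
    (c : Unitization ℤ R) (a : R) (ha : a ∈ I) :
    ∃ b ∈ I, (Unitization.inr b : Unitization ℤ R) = c * Unitization.inr a := by
  refine ⟨c.fst • a + c.snd * a, I.add_mem (I.zsmul_mem _ ha) (I.mul_mem_left _ _ ha), ?_⟩
  ext <;> simp [-zsmul_eq_mul]

theorem Matrix.fromCols_mul_fromBlocks_mul_fromRows_zero {R ι κ μ ν : Type*} [NonUnitalRing R]
    [Fintype κ] [Fintype μ] (a : Matrix ι κ R) (z : Matrix κ μ R) (y : Matrix μ ν R) :
    (fromCols a 0 : Matrix ι (κ ⊕ μ) R) * (fromBlocks 0 z 0 0 : Matrix (κ ⊕ μ) (κ ⊕ μ) R) *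
      (fromRows 0 y : Matrix (κ ⊕ μ) ν R) = a * z * y := by
  ext i j
  simp [Matrix.mul_apply]

theorem IsQuasipure.condII {R : Type*} [NonUnitalRing R] {I : TwoSidedIdeal R}
    (h : IsQuasipure I) : CondII I := by
  intro n x hx
  obtain ⟨m, s, y, hs, hy, hsy, a, b, rfl⟩ := h n x hx
  refine ⟨m, a.map Unitization.inr, y * b, s, I.matrix_mul_mem_right b hy, hs, ?_, ?_⟩
  · rw [Matrix.mul_assoc]
    exact Matrix.map_mul (f := Unitization.inrNonUnitalAlgHom ℤ R)
  · rw [← Matrix.mul_assoc, hsy]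

theorem CondII.condIII {R : Type*} [NonUnitalRing R] {I : TwoSidedIdeal R}
    (h : CondII I) : CondIII I := by
  intro n x hx
  obtain ⟨m, r, y, s, hy, hs, hxr, hsy⟩ := h n x hx
  obtain ⟨t, ht, rfl⟩ := I.exists_eq_mul_of_map_eq_mul
    (φ := (Unitization.inrNonUnitalAlgHom ℤ R : R →ₙ+* Unitization ℤ R)) (r := r)
    Unitization.inr_injective I.exists_inr_eq_mul hs (by exact hxr) hsy
  exact ⟨m, t, y, s, ht, hy, hs, rfl, hsy⟩

theorem CondIII.condII {R : Type*} [NonUnitalRing R] {I : TwoSidedIdeal R}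
    (h : CondIII I) : CondII I := by
  intro n x hx
  obtain ⟨m, r, y, s, -, hy, hs, rfl, hsy⟩ := h n x hx
  exact ⟨m, r.map Unitization.inr, y, s, hy, hs,
    Matrix.map_mul (f := Unitization.inrNonUnitalAlgHom ℤ R), hsy⟩

theorem CondIII.isQuasipure {R : Type*} [NonUnitalRing R] {I : TwoSidedIdeal R}
    (h : CondIII I) : IsQuasipure I := by
  intro n x hx
  obtain ⟨m, r, y, s, -, -, hs, rfl, hsy⟩ := h n x hx
  obtain ⟨p, q, z, t, -, hz, ht, rfl, htz⟩ := h m s hs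
  -- `r * y = (r * q) * z * y`; pad `z` with zeros to make it square.
  let e := (finSumFinEquiv (m := p) (n := m)).symm
  refine ⟨p + m, (fromBlocks t 0 0 0).submatrix e e, (fromBlocks 0 z 0 0).submatrix e e,
    fun i j => ?_, fun i j => ?_, ?_, (fromCols (r * q) 0).submatrix id e,
    (fromRows 0 y).submatrix e id, ?_⟩
  · rw [Matrix.submatrix_apply]
    rcases e i with i | i <;> rcases e j with j | j <;> simp [ht, I.zero_mem]
  · rw [Matrix.submatrix_apply]
    rcases e i with i | i <;> rcases e j with j | j <;> simp [hz, I.zero_mem]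
  · rw [Matrix.submatrix_mul_equiv, fromBlocks_multiply]
    simp [htz]
  · rw [Matrix.submatrix_mul_equiv, Matrix.submatrix_mul_equiv, Matrix.submatrix_id_id,
      Matrix.fromCols_mul_fromBlocks_mul_fromRows_zero, Matrix.mul_assoc r q z,
      Matrix.mul_assoc r, hsy]

theorem stmt10 {R : Type*} [NonUnitalRing R] (I : TwoSidedIdeal R) :
    (IsQuasipure I ↔ CondII I) ∧ (CondII I ↔ CondIII I) := by
  exact ⟨⟨IsQuasipure.condII, fun h => h.condIII.isQuasipure⟩, CondII.condIII, CondIII.condII⟩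
end

section
/- Let R be a unital ring and let I be a two-sided ideal of R. Then I is quasipure if and only if for every finite subset X ⊆ I there exist finitely generated left ideals J₁ ⊆ J₂ of R with J₂ ⊆ I, such that X ⊆ J₁ and J₂J₁ = J₁, where J₂J₁ denotes the additive subgroup of R generated by all products a * b with a ∈ J₂ and b ∈ J₁. -/
open Matrix

/-- Square matrices `s`, `y` indexed by an arbitrary finite type can be reindexed by some `Fin m`
without losing `s * y = y`, the membership of the entries in `I`, or `x ≾₁ y`. -/
theorem exists_fin_of_precsim1 {R ι κ : Type*} [NonUnitalRing R] [Fintype ι] [Fintype κ]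
    (I : TwoSidedIdeal R) {x : Matrix ι ι R} {s y : Matrix κ κ R}
    (hs : ∀ i j, s i j ∈ I) (hy : ∀ i j, y i j ∈ I) (hsy : s * y = y) (hxy : Precsim1 x y) :
    ∃ (m : ℕ) (s y : Matrix (Fin m) (Fin m) R),
      (∀ i j, s i j ∈ I) ∧ (∀ i j, y i j ∈ I) ∧ s * y = y ∧ Precsim1 x y := by
  classical
  obtain ⟨a, b, rfl⟩ := hxy
  let e := (Fintype.equivFin κ).symm
  refine ⟨Fintype.card κ, s.submatrix e e, y.submatrix e e, fun i j => hs _ _, fun i j => hy _ _,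
    ?_, a.submatrix id e, b.submatrix e id, ?_⟩
  · rw [Matrix.submatrix_mul_equiv, hsy]
  · rw [Matrix.submatrix_mul_equiv, Matrix.submatrix_mul_equiv, Matrix.submatrix_id_id]

/-- If the column `z` over `I` is fixed by a matrix over `I`, then any square matrix with entries in
the left ideal generated by `z` is `≾₁ y` for some `y` over `I` fixed by a matrix over `I`. -/
theorem exists_precsim1_of_mulVec_eq {R ι κ : Type*} [Ring R] [Fintype ι] [Fintype κ]
    (I : TwoSidedIdeal R) {z : κ → R} {t : Matrix κ κ R} (hz : ∀ k, z k ∈ I)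
    (ht : ∀ k l, t k l ∈ I) (htz : t *ᵥ z = z) {x : Matrix ι ι R}
    (hx : ∀ i j, x i j ∈ Submodule.span R (Set.range z)) :
    ∃ (m : ℕ) (s y : Matrix (Fin m) (Fin m) R),
      (∀ i j, s i j ∈ I) ∧ (∀ i j, y i j ∈ I) ∧ s * y = y ∧ Precsim1 x y := by
  classical
  simp only [Submodule.mem_span_range_iff_exists_fun, smul_eq_mul] at hx
  choose c hc using hx
  let Z : Matrix (ι × κ) ι R := Matrix.of fun p j => if p.1 = j then z p.2 else 0
  let S : Matrix (ι × κ) (ι × κ) R := Matrix.of fun p q => if p.1 = q.1 then t p.2 q.2 else 0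
  let C : Matrix ι (ι × κ) R := Matrix.of fun i p => c i p.1 p.2
  have hSZ : S * Z = Z := by
    ext ⟨i, k⟩ j
    have h := congrFun htz k
    simp only [Matrix.mulVec, dotProduct] at h
    simp only [S, Z, Matrix.mul_apply, Matrix.of_apply, Fintype.sum_prod_type]
    rw [Finset.sum_eq_single i (by intro b _ hb; simp [hb.symm]) (by simp)]
    by_cases hij : i = j <;> simp [hij, h]
  have hCZ : x = C * Z := by
    ext i j
    simp only [C, Z, Matrix.mul_apply, Matrix.of_apply, Fintype.sum_prod_type]
    rw [Finset.sum_eq_single j (by intro b _ hb; simp [hb]) (by simp)]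
    simp [hc]
  refine exists_fin_of_precsim1 I (s := Matrix.fromBlocks S 0 0 (0 : Matrix ι ι R))
    (y := Matrix.fromBlocks 0 Z 0 0) ?_ ?_ ?_
    ⟨Matrix.fromCols C 0, Matrix.fromRows 0 1, ?_⟩
  · rintro (p | i) (q | j) <;> simp only [Matrix.fromBlocks_apply₁₁, Matrix.fromBlocks_apply₁₂,
      Matrix.fromBlocks_apply₂₁, Matrix.fromBlocks_apply₂₂, Matrix.zero_apply, I.zero_mem]
    simp only [S, Matrix.of_apply]
    split_ifs
    exacts [ht _ _, I.zero_mem]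
  · rintro (p | i) (q | j) <;> simp only [Matrix.fromBlocks_apply₁₁, Matrix.fromBlocks_apply₁₂,
      Matrix.fromBlocks_apply₂₁, Matrix.fromBlocks_apply₂₂, Matrix.zero_apply, I.zero_mem]
    simp only [Z, Matrix.of_apply]
    split_ifs
    exacts [hz _, I.zero_mem]
  · simp [Matrix.fromBlocks_multiply, hSZ]
  · rw [Matrix.fromCols_mul_fromBlocks, Matrix.fromCols_mul_fromRows]
    simp [hCZ]

/-- If `J₂` is contained in the two-sided ideal `I`, then every element of the product of `J₂` with
the left ideal generated by `z` is a linear combination of the `z k` with coefficients in `I`. -/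
theorem exists_sum_mul_eq_of_mem_closure {R κ : Type*} [Ring R] [Fintype κ]
    (I : TwoSidedIdeal R) {J₂ : Submodule R R} (hJ₂ : (J₂ : Set R) ⊆ (I : Set R)) {z : κ → R}
    {u : R} (hu : u ∈ AddSubgroup.closure
      {w : R | ∃ a ∈ J₂, ∃ b ∈ Submodule.span R (Set.range z), w = a * b}) :
    ∃ t : κ → R, (∀ k, t k ∈ I) ∧ ∑ k, t k * z k = u := by
  induction hu using AddSubgroup.closure_induction with
  | mem w hw =>
    obtain ⟨a, ha, b, hb, rfl⟩ := hw
    obtain ⟨c, rfl⟩ := (Submodule.mem_span_range_iff_exists_fun R).1 hb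
    exact ⟨fun k => a * c k, fun k => I.mul_mem_right _ _ (hJ₂ ha),
      by simp [Finset.mul_sum, mul_assoc]⟩
  | zero => exact ⟨0, fun k => I.zero_mem, by simp⟩
  | add _ _ _ _ h₁ h₂ =>
    obtain ⟨t₁, ht₁, rfl⟩ := h₁
    obtain ⟨t₂, ht₂, rfl⟩ := h₂
    exact ⟨t₁ + t₂, fun k => I.add_mem (ht₁ k) (ht₂ k), by simp [add_mul, Finset.sum_add_distrib]⟩
  | neg _ _ h =>
    obtain ⟨t, ht, rfl⟩ := h
    exact ⟨-t, fun k => I.neg_mem (ht k), by simp⟩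

/-- If `s * z = z`, then the left ideal generated by the entries of `z` equals its product with any
left ideal containing the entries of `s`. -/
theorem closure_mul_span_range_eq {R κ ι : Type*} [Ring R] [Fintype κ]
    {s : Matrix κ κ R} {z : Matrix κ ι R} (hsz : s * z = z) {J₂ : Submodule R R}
    (hs : ∀ i j, s i j ∈ J₂) :
    AddSubgroup.closure {w : R | ∃ a ∈ J₂,
        ∃ b ∈ Submodule.span R (Set.range fun p : κ × ι => z p.1 p.2), w = a * b} =
      (Submodule.span R (Set.range fun p : κ × ι => z p.1 p.2)).toAddSubgroup := by
  apply le_antisymm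
  · rw [AddSubgroup.closure_le]
    rintro _ ⟨a, -, b, hb, rfl⟩
    exact Submodule.smul_mem _ a hb
  · intro w hw
    rw [Submodule.mem_toAddSubgroup] at hw
    induction hw using Submodule.closure_induction with
    | zero => exact zero_mem _
    | add _ _ _ _ h₁ h₂ => exact add_mem h₁ h₂
    | smul_mem r _ h =>
      obtain ⟨⟨k, i⟩, rfl⟩ := h
      have h : r • z k i = ∑ l, (r * s k l) * z l i := by
        conv_lhs => rw [← hsz]
        simp [Matrix.mul_apply, Finset.mul_sum, mul_assoc]
      simp only [h]
      exact sum_mem fun l _ => AddSubgroup.subset_closure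
        ⟨_, J₂.smul_mem r (hs k l), _, Submodule.subset_span ⟨(l, i), rfl⟩, rfl⟩

theorem stmt11 {R : Type*} [Ring R] (I : TwoSidedIdeal R) :
    IsQuasipure I ↔
      ∀ X : Finset R, (↑X : Set R) ⊆ (I : Set R) →
        ∃ J₁ J₂ : Submodule R R, J₁.FG ∧ J₂.FG ∧ J₁ ≤ J₂ ∧
          (J₂ : Set R) ⊆ (I : Set R) ∧ (↑X : Set R) ⊆ (J₁ : Set R) ∧
          AddSubgroup.closure {z : R | ∃ a ∈ J₂, ∃ b ∈ J₁, z = a * b} =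
            J₁.toAddSubgroup := by
  classical
  constructor
  · intro h X hX
    obtain ⟨m, s, y, hs, hy, hsy, a, b, hab⟩ :=
      h X.card (Matrix.diagonal fun i => (X.equivFin.symm i : R)) (fun i j => by
        rw [Matrix.diagonal_apply]
        split_ifs
        exacts [hX (X.equivFin.symm i).2, I.zero_mem])
    have hsz : s * (y * b) = y * b := by rw [← Matrix.mul_assoc, hsy]
    rw [Matrix.mul_assoc] at hab
    have hz : ∀ i j, (y * b) i j ∈ I := fun i j => by
      rw [Matrix.mul_apply]
      exact sum_mem fun k _ => I.mul_mem_right _ _ (hy i k)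
    generalize y * b = z at hsz hab hz
    let J₁ := Submodule.span R (Set.range fun p : Fin m × Fin X.card => z p.1 p.2)
    let S := Submodule.span R (Set.range fun p : Fin m × Fin m => s p.1 p.2)
    have hJ₁ : J₁.FG := Submodule.fg_span (Set.finite_range _)
    refine ⟨J₁, S ⊔ J₁, hJ₁, (Submodule.fg_span (Set.finite_range _)).sup hJ₁, le_sup_right,
      ?_, ?_, ?_⟩
    · have hI : S ⊔ J₁ ≤ I.asIdeal := by
        refine sup_le (Submodule.span_le.2 ?_) (Submodule.span_le.2 ?_)
        · rintro _ ⟨p, rfl⟩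
          exact TwoSidedIdeal.mem_asIdeal.2 (hs _ _)
        · rintro _ ⟨p, rfl⟩
          exact TwoSidedIdeal.mem_asIdeal.2 (hz _ _)
      exact fun w hw => TwoSidedIdeal.mem_asIdeal.1 (hI hw)
    · intro w hw
      have hw' := congrFun₂ hab (X.equivFin ⟨w, hw⟩) (X.equivFin ⟨w, hw⟩)
      rw [Matrix.diagonal_apply_eq, Equiv.symm_apply_apply, Matrix.mul_apply] at hw'
      rw [SetLike.mem_coe, show w = _ from hw']
      exact sum_mem fun k _ => J₁.smul_mem _ (Submodule.subset_span ⟨(k, _), rfl⟩)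
    · exact closure_mul_span_range_eq hsz fun i j =>
        Submodule.mem_sup_left (Submodule.subset_span ⟨(i, j), rfl⟩)
  · intro h n x hx
    obtain ⟨J₁, J₂, hJ₁, -, hle, hJ₂, hX, hmul⟩ :=
      h (Finset.univ.image fun p : Fin n × Fin n => x p.1 p.2) (by
        intro w hw
        obtain ⟨p, -, rfl⟩ := Finset.mem_image.1 (Finset.mem_coe.1 hw)
        exact hx _ _)
    obtain ⟨p, z, rfl⟩ := Submodule.fg_iff_exists_fin_generating_family.1 hJ₁
    have hz : ∀ k, z k ∈ Submodule.span R (Set.range z) := fun k =>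
      Submodule.subset_span ⟨k, rfl⟩
    have hcomb : ∀ k, ∃ t : Fin p → R, (∀ l, t l ∈ I) ∧ ∑ l, t l * z l = z k := fun k =>
      exists_sum_mul_eq_of_mem_closure I hJ₂ (by rw [hmul]; exact hz k)
    choose t ht htz using hcomb
    exact exists_precsim1_of_mulVec_eq I (t := t) (fun k => hJ₂ (hle (hz k))) ht (funext htz)
      fun i j => hX (Finset.mem_coe.2 (Finset.mem_image.2 ⟨(i, j), Finset.mem_univ _, rfl⟩))
end

section
/- Let R be a (possibly non-unital) associative ring and let I be a two-sided ideal of R such that: (a) I is idempotent, i.e., every element of I is a finite sum of products y*z with y, z ∈ I; and (b) I is finitely generated as a left ideal, i.e., there is a finite set G ⊆ I such that every element of I is a finite sum of elements of the form n·g (with n ∈ ℤ, g ∈ G) and r·g (with r ∈ R, g ∈ G). Then I is quasipure. -/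
open Matrix

/-- Matrices `x` with `x ≾₁ y` for some square matrix `y` over `I` having a left unit over `I`. -/
def HasLeftUnitalBound {R : Type*} [NonUnitalRing R] (I : TwoSidedIdeal R) {ι : Type*} [Fintype ι]
    (x : Matrix ι ι R) : Prop :=
  ∃ (m : ℕ) (s y : Matrix (Fin m) (Fin m) R),
    (∀ i j, s i j ∈ I) ∧ (∀ i j, y i j ∈ I) ∧ s * y = y ∧ Precsim1 x y

namespace HasLeftUnitalBound

variable {R : Type*} [NonUnitalRing R] {I : TwoSidedIdeal R} {ι : Type*} [Fintype ι]

/-- The bounding matrix may be indexed by an arbitrary finite type. -/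
theorem of_fintype {κ : Type*} [Fintype κ] {x : Matrix ι ι R} {s y : Matrix κ κ R}
    (hs : ∀ i j, s i j ∈ I) (hy : ∀ i j, y i j ∈ I) (hsy : s * y = y) (hxy : Precsim1 x y) :
    HasLeftUnitalBound I x := by
  obtain ⟨a, b, rfl⟩ := hxy
  let e := (Fintype.equivFin κ).symm
  refine ⟨_, s.submatrix e e, y.submatrix e e, fun _ _ => hs _ _, fun _ _ => hy _ _, ?_,
    a.submatrix id e, b.submatrix e id, ?_⟩
  · rw [Matrix.submatrix_mul_equiv, hsy]
  · rw [Matrix.submatrix_mul_equiv, Matrix.submatrix_mul_equiv, Matrix.submatrix_id_id]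

theorem zero : HasLeftUnitalBound I (0 : Matrix ι ι R) :=
  ⟨0, 0, 0, fun _ _ => I.zero_mem, fun _ _ => I.zero_mem, by simp, 0, 0, by simp⟩

theorem neg {x : Matrix ι ι R} (hx : HasLeftUnitalBound I x) : HasLeftUnitalBound I (-x) := by
  obtain ⟨m, s, y, hs, hy, hsy, a, b, rfl⟩ := hx
  exact ⟨m, s, y, hs, hy, hsy, -a, b, by simp⟩

theorem add {x x' : Matrix ι ι R} (hx : HasLeftUnitalBound I x) (hx' : HasLeftUnitalBound I x') :
    HasLeftUnitalBound I (x + x') := by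
  obtain ⟨m, s, y, hs, hy, hsy, a, b, rfl⟩ := hx
  obtain ⟨m', s', y', hs', hy', hsy', a', b', rfl⟩ := hx'
  refine of_fintype (s := fromBlocks s 0 0 s') (y := fromBlocks y 0 0 y') ?_ ?_ ?_
    ⟨fromCols a a', fromRows b b', ?_⟩
  · rintro (i | i) (j | j) <;> simp [hs, hs', I.zero_mem]
  · rintro (i | i) (j | j) <;> simp [hy, hy', I.zero_mem]
  · simp [fromBlocks_multiply, hsy, hsy']
  · ext i j; simp [Matrix.mul_apply, Fintype.sum_sum_type]

theorem sum {α : Type*} (t : Finset α) {f : α → Matrix ι ι R}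
    (hf : ∀ i ∈ t, HasLeftUnitalBound I (f i)) : HasLeftUnitalBound I (∑ i ∈ t, f i) :=
  Finset.sum_induction f (HasLeftUnitalBound I) (fun _ _ => add) zero hf

end HasLeftUnitalBound

/-- If `I` is idempotent and generated by `G` as a left ideal, then every element of `I` is a
combination of elements of `G` with coefficients in `I`. -/
theorem exists_eq_sum_mul_of_idempotent {R : Type*} [NonUnitalRing R] {I : TwoSidedIdeal R}
    (hidem : ∀ x ∈ I, x ∈ AddSubgroup.closure {z : R | ∃ y ∈ I, ∃ w ∈ I, z = y * w})
    {G : Finset R}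
    (hfg : ∀ x ∈ I, x ∈ AddSubgroup.closure
      {z : R | (∃ k : ℤ, ∃ g ∈ G, z = k • g) ∨ (∃ r : R, ∃ g ∈ G, z = r * g)})
    {x : R} (hx : x ∈ I) : ∃ f : R → R, (∀ g, f g ∈ I) ∧ x = ∑ g ∈ G, f g * g := by
  classical
  let J : AddSubgroup R :=
    { carrier := {x | ∃ f : R → R, (∀ g, f g ∈ I) ∧ x = ∑ g ∈ G, f g * g}
      zero_mem' := ⟨0, fun _ => I.zero_mem, by simp⟩
      add_mem' := by
        rintro _ _ ⟨f, hf, rfl⟩ ⟨f', hf', rfl⟩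
        exact ⟨f + f', fun g => I.add_mem (hf g) (hf' g), by simp [add_mul, Finset.sum_add_distrib]⟩
      neg_mem' := by
        rintro _ ⟨f, hf, rfl⟩
        exact ⟨-f, fun g => I.neg_mem (hf g), by simp⟩ }
  have mul_mem_J : ∀ c ∈ I, ∀ g ∈ G, c * g ∈ J := fun c hc g hg =>
    ⟨Pi.single g c, fun h => by
      by_cases hh : h = g
      · subst hh; simpa using hc
      · simp [hh, I.zero_mem], by
      rw [Finset.sum_eq_single_of_mem g hg fun h _ hh => by simp [hh]]; simp⟩
  suffices h : AddSubgroup.closure {z : R | ∃ y ∈ I, ∃ w ∈ I, z = y * w} ≤ J from h (hidem x hx)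
  rw [AddSubgroup.closure_le]
  rintro _ ⟨y, hy, w, hw, rfl⟩
  suffices h : AddSubgroup.closure
      {z : R | (∃ k : ℤ, ∃ g ∈ G, z = k • g) ∨ (∃ r : R, ∃ g ∈ G, z = r * g)} ≤
        J.comap (AddMonoidHom.mulLeft y) from h (hfg w hw)
  rw [AddSubgroup.closure_le]
  rintro _ (⟨k, g, hg, rfl⟩ | ⟨r, g, hg, rfl⟩)
  · change y * k • g ∈ J
    rw [mul_smul_comm]
    exact J.zsmul_mem (mul_mem_J y hy g hg) k
  · change y * (r * g) ∈ J
    rw [← mul_assoc]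
    exact mul_mem_J _ (I.mul_mem_right _ _ hy) g hg

/-- A matrix unit scaled by `c * g * w`, where `g` lies in a finite subset `G` of `I` that is
reproduced by coefficients in `I`, has a left unital bound. -/
theorem HasLeftUnitalBound.single_mul_mul {R : Type*} [NonUnitalRing R] {I : TwoSidedIdeal R}
    {ι : Type*} [Fintype ι] [DecidableEq ι] {G : Finset R} (hG : (↑G : Set R) ⊆ (I : Set R))
    (hG' : ∀ h ∈ G, ∃ f : R → R, (∀ g, f g ∈ I) ∧ h = ∑ g ∈ G, f g * g)
    (i j : ι) (c w : R) {g : R} (hg : g ∈ G) :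
    HasLeftUnitalBound I (Matrix.single i j (c * g * w)) := by
  classical
  choose! f hf hsum using hG'
  refine of_fintype (κ := G) (s := Matrix.of fun h k => f h k) (y := Matrix.of fun h _ => (h : R))
    (fun h k => hf h h.2 k) (fun h _ => hG h.2) ?_
    ⟨Matrix.single i ⟨g, hg⟩ c, Matrix.single ⟨g, hg⟩ j w, ?_⟩
  · ext h k
    simp only [Matrix.mul_apply, Matrix.of_apply]
    rw [Finset.sum_coe_sort G fun k => f h k * k]
    exact (hsum h h.2).symm
  · rw [Matrix.single_mul_mul_single]
    simp

theorem stmt12 {R : Type*} [NonUnitalRing R] (I : TwoSidedIdeal R)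
    (hidem : ∀ x ∈ I, x ∈ AddSubgroup.closure {z : R | ∃ y ∈ I, ∃ w ∈ I, z = y * w})
    (G : Finset R) (hG : (↑G : Set R) ⊆ (I : Set R))
    (hfg : ∀ x ∈ I, x ∈ AddSubgroup.closure
      {z : R | (∃ k : ℤ, ∃ g ∈ G, z = k • g) ∨ (∃ r : R, ∃ g ∈ G, z = r * g)}) :
    IsQuasipure I := by
  intro n x hx
  change HasLeftUnitalBound I x
  rw [Matrix.matrix_eq_sum_single x]
  refine .sum _ fun i _ => .sum _ fun j _ => ?_
  have hxij := hidem _ (hx i j)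
  generalize x i j = r at hxij ⊢
  induction hxij using AddSubgroup.closure_induction with
  | mem z hz =>
    obtain ⟨y, hy, w, -, rfl⟩ := hz
    obtain ⟨f, -, rfl⟩ := exists_eq_sum_mul_of_idempotent hidem hfg hy
    rw [Finset.sum_mul, ← Matrix.singleAddMonoidHom_apply, map_sum]
    exact .sum _ fun g hg => .single_mul_mul hG
      (fun h hh => exists_eq_sum_mul_of_idempotent hidem hfg (hG hh)) i j _ _ hg
  | zero => simpa using HasLeftUnitalBound.zero
  | add y z _ _ hy hz => simpa [Matrix.single_add] using hy.add hz
  | neg z _ hz => simpa [Matrix.single_neg] using hz.neg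
end

section
/- Let T be a (possibly non-unital) associative ring and let J be a two-sided ideal of T. Let (x_n)_{n≥1} be a sequence of elements of J such that for every n there exists y_{n+1} ∈ T with x_n = y_{n+1} * x_{n+1} * x_n. Then for every n there exists z_{n+1} ∈ J with x_n = z_{n+1} * x_{n+1} * x_n. -/
theorem stmt13 {T : Type*} [NonUnitalRing T] (J : TwoSidedIdeal T)
    (x : ℕ → T) (hx : ∀ n, x n ∈ J)
    (hseq : ∀ n, ∃ y : T, x n = y * x (n + 1) * x n) :
    ∀ n, ∃ z ∈ J, x n = z * x (n + 1) * x n := by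
  intro n
  obtain ⟨y, hy⟩ := hseq n
  obtain ⟨w, hw⟩ := hseq (n + 1)
  refine ⟨y * (w * x (n + 1 + 1)), J.mul_mem_left _ _ (J.mul_mem_left _ _ (hx _)), ?_⟩
  rw [mul_assoc y, ← hw]
  exact hy
end

section
/- Let T be a (possibly non-unital) associative ring and let J be a two-sided ideal of T such that for every x ∈ J there exist r, s, y ∈ J with x = r * y and s * y = y. Then for every x ∈ J there exist a sequence (x_n)_{n≥1} of elements of J, a sequence (z_n)_{n≥2} of elements of J, and elements a, b ∈ T, such that x = a * x₁ * b and x_n = z_{n+1} * x_{n+1} * x_n for every n ≥ 1. -/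
theorem stmt14 {T : Type*} [NonUnitalRing T] (J : TwoSidedIdeal T)
    (h : ∀ x ∈ J, ∃ r ∈ J, ∃ s ∈ J, ∃ y ∈ J, x = r * y ∧ s * y = y) :
    ∀ x ∈ J, ∃ (xs zs : ℕ → T) (a b : T),
      (∀ n, xs n ∈ J) ∧ (∀ n, zs n ∈ J) ∧
      x = a * xs 0 * b ∧ ∀ n, xs n = zs n * xs (n + 1) * xs n := by
  intro x hx
  have h' : ∀ t : {t // t ∈ J}, ∃ r s y : {t // t ∈ J},
      (t : T) = r * y ∧ (s : T) * y = y := by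
    rintro ⟨t, ht⟩
    obtain ⟨r, hr, s, hs, y, hy, h₁, h₂⟩ := h t ht
    exact ⟨⟨r, hr⟩, ⟨s, hs⟩, ⟨y, hy⟩, h₁, h₂⟩
  choose r s y hfac hfix using h'
  have key (t) : (y t : T) = r (s t) * y (s t) * y t := by
    rw [← hfac, hfix]
  let t (n : ℕ) : {t // t ∈ J} := s^[n] ⟨x, hx⟩
  have ht (n : ℕ) : t (n + 1) = s (t n) := Function.iterate_succ_apply' s n _
  refine ⟨fun n => y (t (n + 1)), fun n => r (t (n + 2)), r (t 0) * r (t 1), y (t 0),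
    fun n => (y _).2, fun n => (r _).2, ?_, fun n => ?_⟩
  · calc x = r (t 0) * y (t 0) := hfac ⟨x, hx⟩
      _ = r (t 0) * (r (t 1) * y (t 1) * y (t 0)) := congrArg _ (key (t 0))
      _ = r (t 0) * r (t 1) * y (t 1) * y (t 0) := by simp only [mul_assoc]
  · simpa only [← ht] using key (t (n + 1))
end

section
/- Let R be a (possibly non-unital) associative ring, let I be a decomposable two-sided ideal of R, and let π : R → R/I be the quotient map, applied entrywise to matrices. Let x be an n×n matrix over R and y an m×m matrix over R such that π(x) ≾₁ π(y) over R/I. Then there exist k and a k×k matrix z over R all of whose entries lie in I, such that x ≾₁ diag(y, z), the (m+k)×(m+k) block-diagonal matrix with diagonal blocks y and z. -/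
open Matrix

theorem stmt15 {R : Type*} [NonUnitalRing R] (I : TwoSidedIdeal R)
    (hI : IsDecomposable I)
    {n m : ℕ} (x : Matrix (Fin n) (Fin n) R) (y : Matrix (Fin m) (Fin m) R)
    (h : Precsim1 (x.map I.ringCon.toQuotient) (y.map I.ringCon.toQuotient)) :
    ∃ (k : ℕ) (z : Matrix (Fin k) (Fin k) R), (∀ i j, z i j ∈ I) ∧
      Precsim1 x (Matrix.fromBlocks y 0 0 z) := by
  obtain ⟨a', b', hab⟩ := h
  have hsurj : Function.Surjective I.ringCon.toQuotient := Quotient.mk_surjective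
  choose s hs using hsurj
  set a := a'.map s
  set b := b'.map s
  have ha : a' = a.map I.ringCon.toQuotient := by ext; simp [a, hs]
  have hb : b' = b.map I.ringCon.toQuotient := by ext; simp [b, hs]
  let f : R →ₙ+* I.ringCon.Quotient :=
    { toFun := I.ringCon.toQuotient
      map_mul' := fun _ _ => rfl
      map_zero' := rfl
      map_add' := fun _ _ => rfl }
  have hmap : x.map f = (a * y * b).map f := by
    rw [Matrix.map_mul, Matrix.map_mul]
    exact ha ▸ hb ▸ hab
  have hc : ∀ i j, (x - a * y * b) i j ∈ I := fun i j => by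
    rw [Matrix.sub_apply, ← TwoSidedIdeal.rel_iff]
    exact (RingCon.eq _).1 (congrFun (congrFun hmap i) j)
  obtain ⟨k, z, hz, d, e, hde⟩ := hI n _ hc
  refine ⟨k, z, hz, Matrix.fromCols a d, Matrix.fromRows b e, ?_⟩
  calc
    x = a * y * b + d * z * e := by rw [← hde, add_sub_cancel]
    _ = Matrix.fromCols a d * Matrix.fromBlocks y 0 0 z * Matrix.fromRows b e := by
      ext i j
      simp [Matrix.mul_apply, Fintype.sum_sum_type]
end

section
/- Let X be a normal topological space and let 𝕂 be either ℝ or ℂ. Let f, g, h : X → 𝕂 be continuous functions such that f = g·f and g = h·g (pointwise products). Then there exist continuous functions f', g' : X → 𝕂 such that f = f'·f, f' = g'·f', and g' = h·g'. -/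
theorem stmt16 {X 𝕂 : Type*} [TopologicalSpace X] [NormalSpace X] [RCLike 𝕂]
    (f g h : C(X, 𝕂)) (hf : f = g * f) (hg : g = h * g) :
    ∃ f' g' : C(X, 𝕂), f = f' * f ∧ f' = g' * f' ∧ g' = h * g' := by
  -- Both functions are obtained by composing `‖g‖` with piecewise linear functions on `ℝ`.
  refine ⟨⟨fun x => ((max 0 (3 * ‖g x‖ - 2) : ℝ) : 𝕂), by fun_prop⟩,
    ⟨fun x => ((min 1 (3 * ‖g x‖ / 2) : ℝ) : 𝕂), by fun_prop⟩, ?_, ?_, ?_⟩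
  · ext x
    by_cases hx : f x = 0
    · simp [hx]
    · have hgx : g x = 1 :=
        (mul_eq_right₀ hx).mp (by simpa using (DFunLike.congr_fun hf x).symm)
      have hmax : max (0 : ℝ) (3 * ‖g x‖ - 2) = 1 := by
        rw [hgx, norm_one]; norm_num
      simp only [ContinuousMap.mul_apply, ContinuousMap.coe_mk, hmax, RCLike.ofReal_one, one_mul]
  · ext x
    simp only [ContinuousMap.mul_apply, ContinuousMap.coe_mk]
    rcases le_total (3 * ‖g x‖ - 2) 0 with hx | hx
    · rw [max_eq_left hx, RCLike.ofReal_zero, mul_zero]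
    · rw [min_eq_left (by linarith : (1 : ℝ) ≤ 3 * ‖g x‖ / 2), RCLike.ofReal_one, one_mul]
  · ext x
    by_cases hx : g x = 0
    · simp [hx]
    · have hhx : h x = 1 :=
        (mul_eq_right₀ hx).mp (by simpa using (DFunLike.congr_fun hg x).symm)
      simp only [ContinuousMap.mul_apply, hhx, one_mul]
end

section
/- Let A be a C*-algebra such that for every n ≥ 1 the C*-algebra M_n(A) of n×n matrices over A is an SAW*-algebra, i.e., for all z, w ∈ M_n(A) with (z* z)(w* w) = 0 there exists v ∈ M_n(A) with (v* v)(z* z) = z* z and (v* v)(w* w) = 0. Then A is left normal: for every n and all a, b, c ∈ M_n(A) with a = b*a and b = c*b, there exist d, e ∈ M_n(A) with a = d*a, d = e*d, and e = c*e. -/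
/-- Matrices over a C*-algebra satisfy the cancellation property of a proper involution. -/
theorem Matrix.eq_zero_of_mul_star_self_eq_zero {A : Type*} [NonUnitalCStarAlgebra A] {n : ℕ}
    {x : Matrix (Fin n) (Fin n) A} (h : x * star x = 0) : x = 0 := by
  let _ := CStarAlgebra.spectralOrder A
  let _ := CStarAlgebra.spectralOrderedRing A
  exact (CStarRing.mul_star_self_eq_zero_iff (E := CStarMatrix (Fin n) (Fin n) A) x).mp h

/-- In a non-unital SAW*-ring with proper involution, if `c * a = a` then some `e` satisfies
`e * a = a` and `c * e = e`. -/
theorem exists_interpolant_of_mul_eq {R : Type*} [NonUnitalRing R] [StarRing R]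
    (hproper : ∀ x : R, x * star x = 0 → x = 0)
    (hsaw : ∀ z w : R, (star z * z) * (star w * w) = 0 →
      ∃ v : R, (star v * v) * (star z * z) = star z * z ∧ (star v * v) * (star w * w) = 0)
    {a c : R} (h : a = c * a) : ∃ e : R, a = e * a ∧ e = c * e := by
  have hw : (c - c * c) * a = 0 := by
    rw [sub_mul, mul_assoc, ← h, ← h, sub_self]
  obtain ⟨v, hv, hvw⟩ := hsaw (star a) (c - c * c) <| by
    rw [star_star, ← mul_assoc, mul_assoc a, ← star_mul, hw, star_zero, mul_zero, zero_mul]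
  set p := star v * v
  have hp : star p = p := by simp [p]
  rw [star_star] at hv
  have hpa : p * a = a := by
    refine sub_eq_zero.mp (hproper _ ?_)
    calc (p * a - a) * star (p * a - a)
        = (p * (a * star a) - a * star a) * star p - (p * (a * star a) - a * star a) := by
          rw [star_sub, star_mul]; noncomm_ring
      _ = 0 := by rw [hv]; simp
  have hpw : p * star (c - c * c) = 0 := by
    refine hproper _ ?_
    rw [star_mul, star_star, hp, ← mul_assoc, mul_assoc p, hvw, zero_mul]
  have hcp : (c - c * c) * p = 0 := by
    simpa [star_mul, hp] using congrArg star hpw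
  refine ⟨c * p, by rw [mul_assoc, hpa, ← h], ?_⟩
  rwa [sub_mul, sub_eq_zero, mul_assoc c c p] at hcp

theorem stmt17 {A : Type*} [NonUnitalCStarAlgebra A]
    (hsaw : ∀ (n : ℕ) (z w : Matrix (Fin n) (Fin n) A),
      (star z * z) * (star w * w) = 0 →
      ∃ v : Matrix (Fin n) (Fin n) A,
        (star v * v) * (star z * z) = star z * z ∧
        (star v * v) * (star w * w) = 0) :
    ∀ (n : ℕ) (a b c : Matrix (Fin n) (Fin n) A),
      a = b * a → b = c * b →
      ∃ d e : Matrix (Fin n) (Fin n) A, a = d * a ∧ d = e * d ∧ e = c * e := by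
  intro n a b c hab hbc
  have hca : a = c * a := by rw [hab, ← mul_assoc, ← hbc]
  obtain ⟨e, hea, hce⟩ := exists_interpolant_of_mul_eq
    (fun _ => Matrix.eq_zero_of_mul_star_self_eq_zero) (hsaw n) hca
  obtain ⟨d, hda, hed⟩ := exists_interpolant_of_mul_eq
    (fun _ => Matrix.eq_zero_of_mul_star_self_eq_zero) (hsaw n) hea
  exact ⟨d, e, hda, hed, hce⟩
end

section
/- Let T be a (possibly non-unital) associative ring with the following property: for all a, b, c ∈ T such that a = b*a and b = c*b, there exist d, e ∈ T with a = d*a, d = e*d, and e = c*e. Then for all a, b, c ∈ T with a = b*a and b = c*b, there exists a sequence (d_n)_{n≥1} of elements of T such that a = d₁*a, d_n = d_{n+1}*d_n for all n, and d_n = c*d_n for all n. -/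
theorem stmt18 {T : Type*} [NonUnitalRing T]
    (hT : ∀ a b c : T, a = b * a → b = c * b →
      ∃ d e : T, a = d * a ∧ d = e * d ∧ e = c * e) :
    ∀ a b c : T, a = b * a → b = c * b →
      ∃ d : ℕ → T, a = d 0 * a ∧ (∀ n, d n = d (n + 1) * d n) ∧ ∀ n, d n = c * d n := by
  intro a b c hab hbc
  let S := {p : T × T // p.1 = p.2 * p.1 ∧ p.2 = c * p.2}
  have step : ∀ p : S, ∃ q : S, p.1.1 = q.1.1 * p.1.1 := by
    rintro ⟨⟨x, y⟩, hxy, hyc⟩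
    obtain ⟨d, e, hxd, hde, hec⟩ := hT x y c hxy hyc
    exact ⟨⟨(d, e), hde, hec⟩, hxd⟩
  choose next hnext using step
  let s : ℕ → S := fun n => next^[n] (next ⟨(a, b), hab, hbc⟩)
  refine ⟨fun n => (s n).1.1, hnext ⟨(a, b), hab, hbc⟩, fun n => ?_, fun n => ?_⟩
  · simp only [s, Function.iterate_succ_apply']
    exact hnext _
  · obtain ⟨hxy, hyc⟩ := (s n).2
    calc (s n).1.1 = (s n).1.2 * (s n).1.1 := hxy
      _ = c * (s n).1.2 * (s n).1.1 := by rw [← hyc]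
      _ = c * (s n).1.1 := by rw [mul_assoc, ← hxy]
end

section
/- Let R be a unital ring that is weakly semihereditary: for all finitely generated projective right R-modules A, B, C and all right R-linear maps f : A → B and g : B → C with g ∘ f = 0, there exist submodules B', B'' of B such that B is the internal direct sum of B' and B'', the range of f is contained in B', and B' is contained in the kernel of g. Then R is left normal: for every n and all a, b, c ∈ M_n(R) with a = b*a and b = c*b, there exist d, e ∈ M_n(R) with a = d*a, d = e*d, and e = c*e. -/
open Matrix in
theorem LinearMap.exists_matrix_mulVec_eq {R m n : Type*} [Semiring R] [Fintype n] [DecidableEq n]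
    (f : (n → R) →ₗ[Rᵐᵒᵖ] (m → R)) : ∃ M : Matrix m n R, ∀ v, M *ᵥ v = f v := by
  refine ⟨Matrix.of fun i j => f (Pi.single j 1) i, fun v => ?_⟩
  ext i
  have hv : v = ∑ j, MulOpposite.op (v j) • (Pi.single j 1 : n → R) := by
    simpa [← Pi.single_smul] using (Finset.univ_sum_single v).symm
  conv_rhs => rw [hv]
  simp [Matrix.mulVec, dotProduct, Finset.sum_apply]

theorem Module.Basis.nonempty_mulOpposite_pi (R n : Type*) [Semiring R] [Finite n] :
    Nonempty (Module.Basis n Rᵐᵒᵖ (n → R)) :=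
  ⟨Module.Basis.ofEquivFun (LinearEquiv.piCongrRight fun _ =>
    { MulOpposite.opAddEquiv with map_smul' := fun _ _ => rfl })⟩


theorem stmt19 {R : Type u} [Ring R]
    (hwsh : ∀ (A B C : Type u) [AddCommGroup A] [AddCommGroup B] [AddCommGroup C]
      [Module Rᵐᵒᵖ A] [Module Rᵐᵒᵖ B] [Module Rᵐᵒᵖ C],
      Module.Finite Rᵐᵒᵖ A → Module.Projective Rᵐᵒᵖ A →
      Module.Finite Rᵐᵒᵖ B → Module.Projective Rᵐᵒᵖ B →
      Module.Finite Rᵐᵒᵖ C → Module.Projective Rᵐᵒᵖ C →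
      ∀ (f : A →ₗ[Rᵐᵒᵖ] B) (g : B →ₗ[Rᵐᵒᵖ] C), g ∘ₗ f = 0 →
        ∃ B' B'' : Submodule Rᵐᵒᵖ B, IsCompl B' B'' ∧
          LinearMap.range f ≤ B' ∧ B' ≤ LinearMap.ker g) :
    ∀ (n : ℕ) (a b c : Matrix (Fin n) (Fin n) R),
      a = b * a → b = c * b →
      ∃ d e : Matrix (Fin n) (Fin n) R, a = d * a ∧ d = e * d ∧ e = c * e := by
  intro n a b c hab hbc
  obtain ⟨basis⟩ := Module.Basis.nonempty_mulOpposite_pi R (Fin n)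
  have hfin : Module.Finite Rᵐᵒᵖ (Fin n → R) := .of_basis basis
  have hproj : Module.Projective Rᵐᵒᵖ (Fin n → R) := .of_basis basis
  let T (M : Matrix (Fin n) (Fin n) R) : (Fin n → R) →ₗ[Rᵐᵒᵖ] (Fin n → R) :=
    Matrix.mulVecBilin R Rᵐᵒᵖ M
  have hT (M : Matrix (Fin n) (Fin n) R) (v : Fin n → R) : T M v = M.mulVec v := rfl
  obtain ⟨P, Q, hPQ, hbP, hPc⟩ := hwsh _ _ _ hfin hproj hfin hproj hfin hproj (T b) (T (1 - c)) (by
    refine LinearMap.ext fun v => ?_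
    simp [hT, Matrix.mulVec_mulVec, sub_mul, ← hbc])
  obtain ⟨e, he⟩ := (P.projection Q hPQ).exists_matrix_mulVec_eq
  have e_mul_b : b = e * b := Matrix.ext_of_mulVec_single fun i => by
    rw [← Matrix.mulVec_mulVec, he]
    exact (Submodule.projection_apply_left hPQ ⟨_, hbP ⟨Pi.single i 1, rfl⟩⟩).symm
  have e_mul_e : e = e * e := Matrix.ext_of_mulVec_single fun i => by
    rw [← Matrix.mulVec_mulVec, he, he]
    exact (Submodule.projection_apply_left hPQ
      ⟨_, Submodule.projection_apply_mem hPQ (Pi.single i 1)⟩).symm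
  have c_mul_e : e = c * e := Matrix.ext_of_mulVec_single fun i => by
    have h := hPc (Submodule.projection_apply_mem hPQ (Pi.single i 1))
    rwa [LinearMap.mem_ker, hT, ← he, Matrix.sub_mulVec, Matrix.one_mulVec, sub_eq_zero,
      Matrix.mulVec_mulVec] at h
  refine ⟨e, e, ?_, e_mul_e, c_mul_e⟩
  calc a = e * b * a := by rw [← e_mul_b, ← hab]
    _ = e * a := by rw [mul_assoc, ← hab]
end
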